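/- Let E be a real Banach space, D ⊊ E a c-John domain (c ≥ 1), and α a c-cone arc joining x, y ∈ D. Let x₀ be a midpoint of α (a point dividing α into two subarcs of equal arclength). Then for any z₁, z₂ ∈ α[x,x₀] one has l_k(α[z₁,z₂]) ≤ 3c·k_D(z₁,z₂) + 3c·log(3c); consequently the quasihyperbolic arclength parametrization of α[x,x₀] is a (3c, 3c·log 3c)-quasi-isometric path into (D, k_D). -/

import Mathlib

open Set Metric

noncomputable section

variable {E : Type*} [NormedAddCommGroup E] [NormedSpace ℝ E]

/-- `deltaBd D z` is the distance `Δ(z)` from `z` to the boundary `∂D`. -/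
def deltaBd (D : Set E) (z : E) : ℝ := Metric.infDist z (frontier D)

/-- `γ` is a rectifiable curve in `D`, parametrized by (norm) arclength on `[0, L]`:
it maps `[0, L]` into `D` and the length of the subarc `γ[γ s, γ t]` equals `t - s`. -/
def IsArcLengthParam (D : Set E) (γ : ℝ → E) (L : ℝ) : Prop :=
  0 ≤ L ∧ (∀ t ∈ Icc (0 : ℝ) L, γ t ∈ D) ∧
    ∀ s t : ℝ, 0 ≤ s → s ≤ t → t ≤ L →
      eVariationOn γ (Icc s t) = ENNReal.ofReal (t - s)

/-- The quasihyperbolic length `l_k(γ[γ a, γ b]) = ∫ ds / Δ` of the subarc between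
parameters `a` and `b` of an arclength-parametrized curve `γ` in `D`. -/
def qhLength (D : Set E) (γ : ℝ → E) (a b : ℝ) : ℝ :=
  ∫ t in a..b, 1 / deltaBd D (γ t)

/-- The quasihyperbolic metric `k_D(x,y)`: the infimum of quasihyperbolic lengths of
rectifiable curves in `D` joining `x` and `y`. -/
def qhDist (D : Set E) (x y : E) : ℝ :=
  sInf { l : ℝ | ∃ γ : ℝ → E, ∃ L : ℝ, IsArcLengthParam D γ L ∧
    γ 0 = x ∧ γ L = y ∧ l = qhLength D γ 0 L }

/-- An arclength-parametrized curve `γ : [0,L] → D` joining `x = γ 0` and `y = γ L` is a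
`b`-cone arc if `min (l (γ[x,z])) (l (γ[z,y])) ≤ b * Δ z` for every point `z = γ t` on `γ`. -/
def IsConeArc (D : Set E) (γ : ℝ → E) (L b : ℝ) : Prop :=
  ∀ t ∈ Icc (0 : ℝ) L, min t (L - t) ≤ b * deltaBd D (γ t)

/-- `D` is a `c`-John domain: every pair of points of `D` can be joined by a `c`-cone arc. -/
def IsJohnDomain (D : Set E) (c : ℝ) : Prop :=
  ∀ x ∈ D, ∀ y ∈ D, ∃ γ : ℝ → E, ∃ L : ℝ,
    IsArcLengthParam D γ L ∧ γ 0 = x ∧ γ L = y ∧ IsConeArc D γ L c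

/-- A curve `γ` in `D` is a `c₀`-neargeodesic if `l_k(γ[x,y]) ≤ c₀ * k_D(x,y)` for all
points `x, y` on `γ`. -/
def IsNeargeodesic (D : Set E) (γ : ℝ → E) (L c₀ : ℝ) : Prop :=
  IsArcLengthParam D γ L ∧
    ∀ s t : ℝ, 0 ≤ s → s ≤ t → t ≤ L →
      qhLength D γ s t ≤ c₀ * qhDist D (γ s) (γ t)

/-- The Gromov product `(x|y)_p` with respect to the quasihyperbolic metric on `D`. -/
def gromovProd (D : Set E) (p x y : E) : ℝ :=
  (qhDist D x p + qhDist D y p - qhDist D x y) / 2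

/-- `(D, k_D)` is Gromov `δ`-hyperbolic. -/
def IsGromovHyperbolic (D : Set E) (δ : ℝ) : Prop :=
  ∀ x ∈ D, ∀ y ∈ D, ∀ z ∈ D, ∀ p ∈ D,
    min (gromovProd D p x y) (gromovProd D p y z) - δ ≤ gromovProd D p x z

end

open MeasureTheory Filter Topology

section QuasihyperbolicAux

/-- The logarithm of a positive `1`-Lipschitz function grows at most as fast as the
integral of its reciprocal. -/
lemma log_sub_log_le_integral_of_lipschitzWith {f : ℝ → ℝ} (hf : LipschitzWith 1 f)
    (hpos : ∀ u, 0 < f u) {a b : ℝ} (hab : a ≤ b) :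
    Real.log (f b) - Real.log (f a) ≤ ∫ u in a..b, 1 / f u := by
  have hcont : Continuous fun u => 1 / f u :=
    continuous_const.div hf.continuous fun u => (hpos u).ne'
  have hderiv : ∀ u, HasDerivAt (fun v => Real.log (f a) + ∫ w in a..v, 1 / f w) (1 / f u) u :=
    fun u => (hcont.integral_hasStrictDerivAt a u).hasDerivAt.const_add _
  have key := image_le_of_liminf_slope_right_le_deriv_boundary
    (f := fun u => Real.log (f u)) (a := a) (b := b)
    (B := fun v => Real.log (f a) + ∫ w in a..v, 1 / f w) (B' := fun u => 1 / f u)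
    (hf.continuous.log fun u => (hpos u).ne').continuousOn
    (by simp)
    (fun u _ => (hderiv u).continuousAt.continuousWithinAt)
    (fun u _ => (hderiv u).hasDerivWithinAt)
    (by
      intro u _ r hr
      refine Eventually.frequently ?_
      filter_upwards [self_mem_nhdsWithin] with z hz
      have hz' : 0 < z - u := sub_pos.2 hz
      refine lt_of_le_of_lt ?_ hr
      rw [slope_def_field, div_le_div_iff₀ hz' (hpos u), ← Real.log_div (hpos z).ne' (hpos u).ne']
      have h1 := Real.log_le_sub_one_of_pos (div_pos (hpos z) (hpos u))
      have h2 : f z - f u ≤ z - u := by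
        have := hf.dist_le_mul z u
        rw [Real.dist_eq, Real.dist_eq, abs_of_pos hz'] at this
        simpa using (le_abs_self _).trans this
      calc Real.log (f z / f u) * f u ≤ (f z / f u - 1) * f u :=
            mul_le_mul_of_nonneg_right h1 (hpos u).le
        _ = f z - f u := by field_simp [(hpos u).ne']
        _ ≤ 1 * (z - u) := by linarith)
  have := key (right_mem_Icc.2 hab)
  linarith

lemma abs_log_sub_log_le_integral_of_lipschitzOnWith {f : ℝ → ℝ} {a b : ℝ} (hab : a ≤ b)
    (hf : LipschitzOnWith 1 f (Icc a b)) (hpos : ∀ u ∈ Icc a b, 0 < f u) :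
    |Real.log (f a) - Real.log (f b)| ≤ ∫ u in a..b, 1 / f u := by
  set F : ℝ → ℝ := fun u => f (projIcc a b hab u) with hF
  have hFeq : ∀ u ∈ Icc a b, F u = f u := fun u hu => by simp [hF, projIcc_of_mem hab hu]
  have hFlip : LipschitzWith 1 F := by
    have := (lipschitzOnWith_iff_restrict.1 hf).comp (LipschitzWith.projIcc hab)
    rwa [one_mul] at this
  have hFpos : ∀ u, 0 < F u := fun u => hpos _ (projIcc a b hab u).2
  have hint : ∫ u in a..b, 1 / F u = ∫ u in a..b, 1 / f u := by
    refine intervalIntegral.integral_congr fun u hu => ?_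
    rw [uIcc_of_le hab] at hu
    simp only [hFeq u hu]
  have h1 := log_sub_log_le_integral_of_lipschitzWith hFlip hFpos hab
  have hneg : LipschitzWith 1 fun u => F (-u) := by
    have := hFlip.comp (LipschitzWith.id.neg (α := ℝ))
    rwa [one_mul] at this
  have h2 := log_sub_log_le_integral_of_lipschitzWith hneg (fun u => hFpos (-u))
    (neg_le_neg hab)
  rw [intervalIntegral.integral_comp_neg (fun u => 1 / F u)] at h2
  simp only [neg_neg, hint, hFeq a (left_mem_Icc.2 hab), hFeq b (right_mem_Icc.2 hab)] at h1 h2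
  exact abs_le.2 ⟨by linarith, h2⟩

variable {E : Type*} [NormedAddCommGroup E] {D : Set E}

lemma deltaBd_pos [NormedSpace ℝ E] (hD : IsOpen D) (hne : D ≠ Set.univ) {z : E} (hz : z ∈ D) :
    0 < deltaBd D z := by
  have hfr : (frontier D).Nonempty := nonempty_frontier_iff.2 ⟨⟨z, hz⟩, hne⟩
  refine (isClosed_frontier.notMem_iff_infDist_pos hfr).1 fun h => ?_
  rw [hD.frontier_eq] at h
  exact h.2 hz

namespace IsArcLengthParam

variable {γ : ℝ → E} {L : ℝ}

lemma lipschitzOnWith (hγ : IsArcLengthParam D γ L) : LipschitzOnWith 1 γ (Icc 0 L) := by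
  have key : ∀ s t : ℝ, 0 ≤ s → s ≤ t → t ≤ L → edist (γ s) (γ t) ≤ edist s t := by
    intro s t hs hst ht
    rw [edist_comm s t, edist_dist t s, Real.dist_eq, abs_of_nonneg (sub_nonneg.2 hst),
      ← hγ.2.2 s t hs hst ht]
    exact eVariationOn.edist_le γ (left_mem_Icc.2 hst) (right_mem_Icc.2 hst)
  intro s hs t ht
  rw [ENNReal.coe_one, one_mul]
  rcases le_total s t with h | h
  · exact key s t hs.1 h ht.2
  · rw [edist_comm, edist_comm s]
    exact key t s ht.1 h hs.2

lemma lipschitzOnWith_deltaBd (hγ : IsArcLengthParam D γ L) :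
    LipschitzOnWith 1 (fun t => deltaBd D (γ t)) (Icc 0 L) := by
  have := (Metric.lipschitz_infDist_pt (frontier D)).comp_lipschitzOnWith hγ.lipschitzOnWith
  rw [one_mul] at this
  exact this

lemma intervalIntegrable [NormedSpace ℝ E] (hD : IsOpen D) (hne : D ≠ Set.univ) (hγ : IsArcLengthParam D γ L)
    {s t : ℝ} (hs : s ∈ Icc 0 L) (ht : t ∈ Icc 0 L) :
    IntervalIntegrable (fun u => 1 / deltaBd D (γ u)) volume s t := by
  have h : ContinuousOn (fun u => 1 / deltaBd D (γ u)) (Icc 0 L) :=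
    continuousOn_const.div hγ.lipschitzOnWith_deltaBd.continuousOn
      fun u hu => (deltaBd_pos hD hne (hγ.2.1 u hu)).ne'
  exact (h.mono (uIcc_subset_Icc hs ht)).intervalIntegrable

lemma shift (hγ : IsArcLengthParam D γ L) {s t : ℝ} (hs : 0 ≤ s) (hst : s ≤ t) (ht : t ≤ L) :
    IsArcLengthParam D (fun u => γ (u + s)) (t - s) := by
  refine ⟨sub_nonneg.2 hst, fun u hu => hγ.2.1 _ ⟨by linarith [hu.1], by linarith [hu.2]⟩, ?_⟩
  intro a b ha hab hb
  have h := eVariationOn.comp_eq_of_monotoneOn γ (t := Icc a b) (fun u => u + s)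
    (fun u _ v _ huv => by simpa using huv)
  have h2 := hγ.2.2 (a + s) (b + s) (by linarith) (by linarith) (by linarith)
  rw [image_add_const_Icc] at h
  rw [add_sub_add_right_eq_sub] at h2
  exact h.trans h2

lemma reverse (hγ : IsArcLengthParam D γ L) : IsArcLengthParam D (fun u => γ (L - u)) L := by
  refine ⟨hγ.1, fun u hu => hγ.2.1 _ ⟨by linarith [hu.2], by linarith [hu.1]⟩, ?_⟩
  intro a b ha hab hb
  have h := eVariationOn.comp_eq_of_antitoneOn γ (t := Icc a b) (fun u => L - u)
    (fun u _ v _ huv => sub_le_sub_left huv L)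
  have h2 := hγ.2.2 (L - b) (L - a) (by linarith) (by linarith) (by linarith)
  rw [image_const_sub_Icc] at h
  rw [sub_sub_sub_cancel_left] at h2
  exact h.trans h2

end IsArcLengthParam

lemma qhLength_nonneg {γ : ℝ → E} {a b : ℝ} (hab : a ≤ b) : 0 ≤ qhLength D γ a b :=
  intervalIntegral.integral_nonneg hab fun _ _ => one_div_nonneg.2 Metric.infDist_nonneg

lemma qhDist_le_qhLength {γ : ℝ → E} {L : ℝ} (hγ : IsArcLengthParam D γ L) :
    qhDist D (γ 0) (γ L) ≤ qhLength D γ 0 L := by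
  refine csInf_le ⟨0, ?_⟩ ⟨γ, L, hγ, rfl, rfl, rfl⟩
  rintro l ⟨β, M, hβ, -, -, rfl⟩
  exact qhLength_nonneg hβ.1

/-- The quasihyperbolic distance between two points of an arc is at most the quasihyperbolic
length of the subarc between them, in either order. -/
lemma qhDist_le_qhLength_subarc {γ : ℝ → E} {L s t : ℝ} (hγ : IsArcLengthParam D γ L)
    (hs : 0 ≤ s) (hst : s ≤ t) (ht : t ≤ L) :
    qhDist D (γ s) (γ t) ≤ qhLength D γ s t ∧ qhDist D (γ t) (γ s) ≤ qhLength D γ s t := by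
  have hsub := hγ.shift hs hst ht
  have hlen : qhLength D (fun u => γ (u + s)) 0 (t - s) = qhLength D γ s t := by
    unfold qhLength
    rw [intervalIntegral.integral_comp_add_right (fun u => 1 / deltaBd D (γ u))]
    simp
  have hrev : qhLength D (fun u => γ (t - s - u + s)) 0 (t - s) = qhLength D γ s t := by
    rw [← hlen]
    unfold qhLength
    rw [intervalIntegral.integral_comp_sub_left (fun u => 1 / deltaBd D (γ (u + s)))]
    simp
  have h1 := qhDist_le_qhLength hsub
  have h2 := qhDist_le_qhLength hsub.reverse
  rw [hlen] at h1
  rw [hrev] at h2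
  simpa using And.intro h1 h2

lemma abs_log_deltaBd_sub_le_qhDist [NormedSpace ℝ E] (hD : IsOpen D) (hne : D ≠ Set.univ) {x y : E}
    (hxy : ∃ γ : ℝ → E, ∃ L : ℝ, IsArcLengthParam D γ L ∧ γ 0 = x ∧ γ L = y) :
    |Real.log (deltaBd D x) - Real.log (deltaBd D y)| ≤ qhDist D x y := by
  obtain ⟨γ, L, hγ, h0, hL⟩ := hxy
  refine le_csInf ⟨_, γ, L, hγ, h0, hL, rfl⟩ ?_
  rintro l ⟨β, M, hβ, rfl, rfl, rfl⟩
  exact abs_log_sub_log_le_integral_of_lipschitzOnWith hβ.1 hβ.lipschitzOnWith_deltaBd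
    fun u hu => deltaBd_pos hD hne (hβ.2.1 u hu)

/-- Along the first half of a cone arc, the quasihyperbolic length of a subarc is controlled
by the ratio of the boundary distances of its end points. -/
lemma IsConeArc.qhLength_le_log [NormedSpace ℝ E] (hD : IsOpen D) (hne : D ≠ Set.univ) {c : ℝ} (hc : 1 ≤ c)
    {α : ℝ → E} {L : ℝ} (hα : IsArcLengthParam D α L) (hcone : IsConeArc D α L c) {s t : ℝ}
    (hs : 0 ≤ s) (hst : s ≤ t) (ht : t ≤ L / 2) :
    qhLength D α s t ≤ 3 * c * |Real.log (deltaBd D (α s)) - Real.log (deltaBd D (α t))|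
      + 3 * c * Real.log (3 * c) := by
  have hL := hα.1
  have hsmem : s ∈ Icc 0 L := ⟨hs, by linarith⟩
  have htmem : t ∈ Icc 0 L := ⟨by linarith, by linarith⟩
  set d := deltaBd D (α s) with hd
  have hdpos : 0 < d := deltaBd_pos hD hne (hα.2.1 s hsmem)
  have hbound : ∀ u ∈ Icc s t, d + (u - s) ≤ 3 * c * deltaBd D (α u) := by
    intro u hu
    have humem : u ∈ Icc 0 L := ⟨hs.trans hu.1, hu.2.trans htmem.2⟩
    have hcu := hcone u humem
    rw [min_eq_left (by linarith [hu.2])] at hcu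
    have hlip := hα.lipschitzOnWith_deltaBd.dist_le_mul s hsmem u humem
    rw [Real.dist_eq, Real.dist_eq, abs_sub_comm s u, abs_of_nonneg (sub_nonneg.2 hu.1),
      NNReal.coe_one, one_mul] at hlip
    have h1 := (le_abs_self _).trans hlip
    have hupos := deltaBd_pos hD hne (hα.2.1 u humem)
    nlinarith [mul_nonneg (sub_nonneg.2 hc) hupos.le]
  have hupos : ∀ u ∈ Icc s t, 0 < d + (u - s) := fun u hu => by linarith [hu.1]
  have hderiv : ∀ u ∈ uIcc s t,
      HasDerivAt (fun v => 3 * c * Real.log (d + (v - s))) (3 * c * (1 / (d + (u - s)))) u := by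
    intro u hu
    rw [uIcc_of_le hst] at hu
    exact ((((hasDerivAt_id u).sub_const s).const_add d).log (hupos u hu).ne').const_mul _
  have hcont : IntervalIntegrable (fun u => 3 * c * (1 / (d + (u - s)))) volume s t := by
    refine ContinuousOn.intervalIntegrable ?_
    rw [uIcc_of_le hst]
    exact continuousOn_const.mul
      (continuousOn_const.div (by fun_prop) fun u hu => (hupos u hu).ne')
  have hle : qhLength D α s t ≤ ∫ u in s..t, 3 * c * (1 / (d + (u - s))) := by
    refine intervalIntegral.integral_mono_on hst
      (hα.intervalIntegrable hD hne hsmem htmem) hcont fun u hu => ?_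
    have hu0 := deltaBd_pos hD hne (hα.2.1 u ⟨hs.trans hu.1, hu.2.trans htmem.2⟩)
    rw [mul_one_div, div_le_div_iff₀ hu0 (hupos u hu), one_mul]
    exact hbound u hu
  rw [intervalIntegral.integral_eq_sub_of_hasDerivAt hderiv hcont] at hle
  have htpos : 0 < deltaBd D (α t) := deltaBd_pos hD hne (hα.2.1 t htmem)
  have hlog : Real.log (d + (t - s)) ≤ Real.log (3 * c) + Real.log (deltaBd D (α t)) := by
    rw [← Real.log_mul (by positivity) htpos.ne']
    exact Real.log_le_log (hupos t (right_mem_Icc.2 hst)) (hbound t (right_mem_Icc.2 hst))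
  have habs := neg_abs_le (Real.log d - Real.log (deltaBd D (α t)))
  rw [sub_self, add_zero, ← mul_sub] at hle
  refine hle.trans ?_
  rw [← mul_add]
  exact mul_le_mul_of_nonneg_left (by linarith) (by positivity)

end QuasihyperbolicAux


/-- Let `D ⊊ E` be a `c`-John domain (`c ≥ 1`) and `α` a `c`-cone arc joining
`x, y ∈ D`, with arclength midpoint `x₀ = α (L/2)`. Then for any `z₁ = α s`, `z₂ = α t` on
`α[x, x₀]` one has `l_k(α[z₁,z₂]) ≤ 3c * k_D(z₁,z₂) + 3c * log (3c)`; consequently the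
quasihyperbolic arclength parametrization of `α[x,x₀]` (whose parameter at `α t` is
`σ t = l_k(α[x, α t]) = qhLength D α 0 t`) is a `(3c, 3c * log (3c))`-quasi-isometric path
into `(D, k_D)`. -/
theorem cone_arc_first_half_is_qh_quasiisometric_path
    {E : Type*} [NormedAddCommGroup E] [NormedSpace ℝ E] [CompleteSpace E]
    (D : Set E) (hD : IsOpen D) (hconn : IsConnected D) (hne : D ≠ Set.univ)
    (c : ℝ) (hc : 1 ≤ c) (hJohn : IsJohnDomain D c)
    (α : ℝ → E) (L : ℝ) (x y : E)
    (hα : IsArcLengthParam D α L) (hx : α 0 = x) (hy : α L = y)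
    (hcone : IsConeArc D α L c) :
    (∀ s t : ℝ, 0 ≤ s → s ≤ t → t ≤ L / 2 →
      qhLength D α s t ≤ 3 * c * qhDist D (α s) (α t) + 3 * c * Real.log (3 * c)) ∧
    (∀ s t : ℝ, s ∈ Icc (0 : ℝ) (L / 2) → t ∈ Icc (0 : ℝ) (L / 2) →
      (3 * c)⁻¹ * |qhLength D α 0 s - qhLength D α 0 t| - 3 * c * Real.log (3 * c)
          ≤ qhDist D (α s) (α t) ∧
      qhDist D (α s) (α t)
          ≤ 3 * c * |qhLength D α 0 s - qhLength D α 0 t| + 3 * c * Real.log (3 * c)) := by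
  have hL := hα.1
  have hpos : 0 < 3 * c := by linarith
  have hlog : 0 ≤ Real.log (3 * c) := Real.log_nonneg (by linarith)
  have hK : 0 ≤ 3 * c * Real.log (3 * c) := mul_nonneg hpos.le hlog
  have hforward : ∀ s t : ℝ, 0 ≤ s → s ≤ t → t ≤ L / 2 →
      qhLength D α s t ≤ 3 * c * qhDist D (α s) (α t) + 3 * c * Real.log (3 * c) ∧
      qhLength D α s t ≤ 3 * c * qhDist D (α t) (α s) + 3 * c * Real.log (3 * c) := by
    intro s t hs hst ht
    have h := hcone.qhLength_le_log hD hne hc hα hs hst ht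
    have hsub := hα.shift hs hst (by linarith)
    have h1 := abs_log_deltaBd_sub_le_qhDist hD hne (x := α s) (y := α t)
      ⟨_, _, hsub, by simp, by simp⟩
    have h2 := abs_log_deltaBd_sub_le_qhDist hD hne (x := α t) (y := α s)
      ⟨_, _, hsub.reverse, by simp, by simp⟩
    rw [abs_sub_comm] at h2
    have h1' := mul_le_mul_of_nonneg_left h1 hpos.le
    have h2' := mul_le_mul_of_nonneg_left h2 hpos.le
    constructor <;> linarith
  have hquasi : ∀ l k : ℝ, 0 ≤ l → l ≤ 3 * c * k + 3 * c * Real.log (3 * c) → k ≤ l →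
      (3 * c)⁻¹ * l - 3 * c * Real.log (3 * c) ≤ k ∧
        k ≤ 3 * c * l + 3 * c * Real.log (3 * c) := by
    intro l k hl hlk hkl
    constructor
    · have h : (3 * c)⁻¹ * l ≤ k + Real.log (3 * c) := by
        rw [inv_mul_le_iff₀ hpos]
        linarith
      nlinarith
    · nlinarith
  have hsub : ∀ s t : ℝ, 0 ≤ s → s ≤ t → t ≤ L / 2 →
      qhLength D α 0 t - qhLength D α 0 s = qhLength D α s t := by
    intro s t hs hst ht
    have h0 : (0 : ℝ) ∈ Icc 0 L := ⟨le_rfl, hL⟩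
    exact intervalIntegral.integral_interval_sub_left
      (hα.intervalIntegrable hD hne h0 ⟨by linarith, by linarith⟩)
      (hα.intervalIntegrable hD hne h0 ⟨by linarith, by linarith⟩)
  refine ⟨fun s t hs hst ht => (hforward s t hs hst ht).1, fun s t hs ht => ?_⟩
  rcases le_total s t with hst | hst
  · have hle := qhDist_le_qhLength_subarc hα hs.1 hst (by linarith [ht.2])
    rw [abs_sub_comm, hsub s t hs.1 hst ht.2, abs_of_nonneg (qhLength_nonneg hst)]
    exact hquasi _ _ (qhLength_nonneg hst) (hforward s t hs.1 hst ht.2).1 hle.1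
  · have hle := qhDist_le_qhLength_subarc hα ht.1 hst (by linarith [hs.2])
    rw [hsub t s ht.1 hst hs.2, abs_of_nonneg (qhLength_nonneg hst)]
    exact hquasi _ _ (qhLength_nonneg hst) (hforward t s ht.1 hst hs.2).2 hle.2
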